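/- arXiv:math/0503134 — 4 statements merged into one kernel-verified Lean document; each statement's English description precedes it below -/
import Mathlib

section
/- Let G be a group and let H₁, H₂ be subgroups of G such that G is generated by H₁ ∪ H₂. Consider the disjoint union (G/H₁) ⊔ (G/H₂) of the two left-coset spaces, and let ∼ be the equivalence relation on it generated by identifying the coset gH₁ with the coset gH₂ for every g ∈ G. Then the quotient ((G/H₁) ⊔ (G/H₂))/∼ has exactly one element. Equivalently, the pushout in the category of sets of the two canonical quotient maps G → G/H₁ and G → G/H₂ is a one-point set. -/
/-- Let `G` be a group generated by two subgroups `H₁` and `H₂`.  Then the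
pushout (in `Set`) of the two quotient maps `G → G/H₁` and `G → G/H₂`, i.e. the quotient of
`(G/H₁) ⊕ (G/H₂)` by the equivalence relation generated by identifying `g·H₁` with `g·H₂`
for every `g ∈ G`, is a one-point set. -/
theorem coset_pushout_subsingleton {G : Type*} [Group G] (H₁ H₂ : Subgroup G)
    (hgen : Subgroup.closure ((H₁ : Set G) ∪ (H₂ : Set G)) = ⊤)
    (r : (G ⧸ H₁) ⊕ (G ⧸ H₂) → (G ⧸ H₁) ⊕ (G ⧸ H₂) → Prop)
    (hr : ∀ x y, r x y ↔ ∃ g : G,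
      x = Sum.inl (QuotientGroup.mk g) ∧ y = Sum.inr (QuotientGroup.mk g)) :
    Nonempty (Quot r) ∧ Subsingleton (Quot r) := by
  have glue (g : G) : Quot.mk r (Sum.inl (g : G ⧸ H₁)) = Quot.mk r (Sum.inr (g : G ⧸ H₂)) :=
    Quot.sound ((hr _ _).2 ⟨g, rfl, rfl⟩)
  have mul_right_invariant (h : G) (g : G) :
      Quot.mk r (Sum.inl ((g * h : G) : G ⧸ H₁)) = Quot.mk r (Sum.inl (g : G ⧸ H₁)) := by
    have hh : h ∈ Subgroup.closure ((H₁ : Set G) ∪ (H₂ : Set G)) := hgen ▸ Subgroup.mem_top h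
    induction hh using Subgroup.closure_induction generalizing g with
    | mem x hx =>
      rcases hx with hx | hx
      · rw [QuotientGroup.mk_mul_of_mem g hx]
      · rw [glue, QuotientGroup.mk_mul_of_mem g hx, ← glue]
    | one => rw [mul_one]
    | mul x y _ _ ihx ihy => rw [← mul_assoc, ihy, ihx]
    | inv x _ ih => rw [← ih (g * x⁻¹), inv_mul_cancel_right]
  have eq_base (q : Quot r) : q = Quot.mk r (Sum.inl ((1 : G) : G ⧸ H₁)) := by
    obtain ⟨x | x, rfl⟩ := Quot.exists_rep q <;>
      obtain ⟨g, rfl⟩ := QuotientGroup.mk_surjective x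
    · simpa using mul_right_invariant g 1
    · rw [← glue]
      simpa using mul_right_invariant g 1
  exact ⟨⟨Quot.mk r (Sum.inl ((1 : G) : G ⧸ H₁))⟩,
    ⟨fun a b => (eq_base a).trans (eq_base b).symm⟩⟩
end

section
/- Let F be a totally real number field, let ℓ be an odd prime, and let γ ∈ GL₂(F) be a non-scalar matrix such that γ^ℓ is a scalar matrix. Then the characteristic polynomial X² − tr(γ)X + det(γ) of γ is irreducible over F, the ℓ-th cyclotomic extension F(ζ_ℓ) of F has degree [F(ζ_ℓ):F] = 2, and the quadratic field F[X]/(X² − tr(γ)X + det(γ)) is isomorphic as an F-algebra to F(ζ_ℓ). -/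
open Polynomial in
/-- The characteristic polynomial of a non-scalar `2 × 2` matrix divides every polynomial
annihilating the matrix. -/
lemma Matrix.charpoly_dvd_of_aeval_eq_zero {F : Type*} [Field F] {M : Matrix (Fin 2) (Fin 2) F}
    (hM : ∀ c : F, M ≠ c • (1 : Matrix (Fin 2) (Fin 2) F)) {q : F[X]} (hq : aeval M q = 0) :
    M.charpoly ∣ q := by
  have hmonic := M.charpoly_monic
  rw [← modByMonic_eq_zero_iff_dvd hmonic]
  have hr : aeval M (q %ₘ M.charpoly) = 0 := by
    rw [aeval_modByMonic_eq_self_of_root M.aeval_self_charpoly, hq]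
  have hdeg : (q %ₘ M.charpoly).degree ≤ 1 := by
    have h := degree_modByMonic_lt q hmonic
    rw [M.charpoly_degree_eq_dim, Fintype.card_fin] at h
    exact Order.le_of_lt_succ h
  rw [eq_X_add_C_of_degree_le_one hdeg] at hr ⊢
  generalize (q %ₘ M.charpoly).coeff 1 = u at hr ⊢
  generalize (q %ₘ M.charpoly).coeff 0 = v at hr ⊢
  have hr' : u • M + v • (1 : Matrix (Fin 2) (Fin 2) F) = 0 := by
    simpa [Algebra.algebraMap_eq_smul_one] using hr
  have hu : u = 0 := by
    by_contra hu
    refine hM (-(u⁻¹ * v)) ?_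
    rw [neg_smul, mul_smul, ← smul_neg, ← eq_neg_of_add_eq_zero_left hr', inv_smul_smul₀ hu]
  subst hu
  have hv : v = 0 := by simpa using congrFun (congrFun hr' 0) 0
  simp [hv]

open Polynomial in
/-- If a separable quadratic `X² - tX + d` divides `Xⁿ - c`, then every root `a` has a conjugate
root `t - a ≠ a`, and both are `n`-th roots of `c`. -/
lemma Polynomial.conjugate_root_of_dvd_X_pow_sub_C {F K : Type*} [Field F] [Field K] [Algebra F K]
    {t d c : F} {n : ℕ} (hsep : (X ^ 2 - C t * X + C d).Separable)
    (hdvd : X ^ 2 - C t * X + C d ∣ X ^ n - C c) {a : K}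
    (ha : aeval a (X ^ 2 - C t * X + C d) = 0) :
    algebraMap F K t - a ≠ a ∧ a ^ n = algebraMap F K c ∧
      (algebraMap F K t - a) ^ n = algebraMap F K c := by
  have hpow : ∀ b : K, aeval b (X ^ 2 - C t * X + C d) = 0 → b ^ n = algebraMap F K c := by
    intro b hb
    simpa [sub_eq_zero] using aeval_eq_zero_of_dvd_aeval_eq_zero hdvd hb
  refine ⟨fun h ↦ ?_, hpow a ha, hpow _ ?_⟩
  · apply hsep.aeval_derivative_ne_zero ha
    simp
    linear_combination -h
  · rw [← ha]
    simp
    ring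

/-- In a field with a real embedding, `n`-th powers are injective for odd `n`. -/
lemma RingHom.eq_of_pow_eq_pow_of_odd {F : Type*} [Field F] (f : F →+* ℝ) {n : ℕ} (hn : Odd n)
    {a b : F} (h : a ^ n = b ^ n) : a = b :=
  f.injective <| hn.pow_injective <| by simp [← map_pow, h]

/-- An extension of prime degree containing a primitive `n`-th root of unity outside the base
field is the `n`-th cyclotomic extension. -/
lemma IsPrimitiveRoot.isCyclotomicExtension_of_finrank_prime {F K : Type*} [Field F] [Field K]
    [Algebra F K] (hK : (Module.finrank F K).Prime) {n : ℕ} [NeZero n] {ζ : K}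
    (hζ : IsPrimitiveRoot ζ n) (hmem : ζ ∉ (⊥ : Subalgebra F K)) :
    IsCyclotomicExtension {n} F K := by
  rw [IsCyclotomicExtension.iff_singleton]
  refine ⟨⟨ζ, hζ⟩, Algebra.eq_top_iff.1 ?_⟩
  have := Subalgebra.isSimpleOrder_of_finrank_prime F K hK
  refine (eq_bot_or_eq_top _).resolve_left fun h ↦ hmem ?_
  rw [← h]
  exact Algebra.subset_adjoin hζ.pow_eq_one

open Polynomial in
/-- Let `F` be a totally real number field, `ℓ` an odd prime, and
`γ ∈ GL₂(F)` a non-scalar matrix whose `ℓ`-th power is scalar.  Then the characteristic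
polynomial of `γ` is irreducible over `F`, the cyclotomic extension `F(ζ_ℓ)` has degree `2`
over `F`, and `F[X]/(charpoly γ) ≅ F(ζ_ℓ)` as `F`-algebras. -/
theorem torsion_in_GL2_totally_real
    (F : Type*) [Field F] [NumberField F]
    (htr : ∀ φ : F →+* ℂ, NumberField.ComplexEmbedding.IsReal φ)
    (ℓ : ℕ+) (hprime : (ℓ : ℕ).Prime) (hodd : Odd (ℓ : ℕ))
    (γ : Matrix.GeneralLinearGroup (Fin 2) F)
    (hnonscalar : ∀ c : F, (γ : Matrix (Fin 2) (Fin 2) F) ≠ c • (1 : Matrix (Fin 2) (Fin 2) F))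
    (hscalar : ∃ c : F,
      ((γ ^ (ℓ : ℕ) : Matrix.GeneralLinearGroup (Fin 2) F) : Matrix (Fin 2) (Fin 2) F)
        = c • (1 : Matrix (Fin 2) (Fin 2) F)) :
    Irreducible (Matrix.charpoly (γ : Matrix (Fin 2) (Fin 2) F)) ∧
    Module.finrank F (CyclotomicField ℓ F) = 2 ∧
    Nonempty ((AdjoinRoot (Matrix.charpoly (γ : Matrix (Fin 2) (Fin 2) F)))
      ≃ₐ[F] CyclotomicField ℓ F) := by
  obtain ⟨c, hc⟩ := hscalar
  obtain ⟨f⟩ : Nonempty (F →+* ℝ) :=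
    ⟨(htr (Classical.arbitrary (F →+* ℂ))).embedding⟩
  have hℓ : ((ℓ : ℕ) : F) ≠ 0 := Nat.cast_ne_zero.2 hprime.ne_zero
  have hc0 : c ≠ 0 := by
    rintro rfl
    exact (γ ^ (ℓ : ℕ)).ne_zero (by simpa using hc)
  set M : Matrix (Fin 2) (Fin 2) F := (γ : Matrix (Fin 2) (Fin 2) F)
  have hdvd : M.charpoly ∣ X ^ (ℓ : ℕ) - C c := by
    refine Matrix.charpoly_dvd_of_aeval_eq_zero hnonscalar ?_
    rw [Units.val_pow_eq_pow_val] at hc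
    simp [M, hc, Algebra.algebraMap_eq_smul_one]
  have hsep : M.charpoly.Separable := (separable_X_pow_sub_C c hℓ hc0).of_dvd hdvd
  have hquad := M.charpoly_fin_two
  have hdeg : M.charpoly.natDegree = 2 := by simp
  have hirr : Irreducible M.charpoly := by
    refine irreducible_of_degree_le_three_of_not_isRoot (by simp [hdeg]) fun a ha ↦ ?_
    rw [hquad] at hdvd hsep ha
    obtain ⟨hne, h₁, h₂⟩ := conjugate_root_of_dvd_X_pow_sub_C hsep hdvd
      (a := a) (by rwa [coe_aeval_eq_eval])
    exact hne (f.eq_of_pow_eq_pow_of_odd hodd (h₂.trans h₁.symm))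
  have : Fact (Irreducible M.charpoly) := ⟨hirr⟩
  have hfin : Module.finrank F (AdjoinRoot M.charpoly) = 2 := by
    rw [(AdjoinRoot.powerBasis hirr.ne_zero).finrank, AdjoinRoot.powerBasis_dim, hdeg]
  have hcyc : IsCyclotomicExtension {(ℓ : ℕ)} F (AdjoinRoot M.charpoly) := by
    have hroot : aeval (AdjoinRoot.root M.charpoly) M.charpoly = 0 := by simp
    generalize AdjoinRoot.root M.charpoly = a at hroot
    rw [hquad] at hdvd hsep
    rw [congrArg (aeval a) hquad] at hroot
    obtain ⟨hne, h₁, h₂⟩ := conjugate_root_of_dvd_X_pow_sub_C hsep hdvd hroot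
    have ha : a ≠ 0 := by
      rintro rfl
      rw [zero_pow hprime.ne_zero, eq_comm, map_eq_zero] at h₁
      exact hc0 h₁
    have hone : (algebraMap F _ M.trace - a) / a ≠ 1 := by rwa [Ne, div_eq_one_iff_eq ha]
    have hpow : ((algebraMap F _ M.trace - a) / a) ^ (ℓ : ℕ) = 1 := by
      rw [div_pow, h₁, h₂, div_self ((_root_.map_ne_zero _).2 hc0)]
    have : Fact (ℓ : ℕ).Prime := ⟨hprime⟩
    have hζ := IsPrimitiveRoot.iff_orderOf.2 (orderOf_eq_prime hpow hone)
    refine hζ.isCyclotomicExtension_of_finrank_prime (hfin.symm ▸ Nat.prime_two) fun hmem ↦ ?_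
    obtain ⟨z, hz⟩ := Algebra.mem_bot.1 hmem
    rw [← hz, ← map_pow, map_eq_one_iff _ (algebraMap F _).injective] at hpow
    have hz1 : z = 1 := f.eq_of_pow_eq_pow_of_odd hodd (hpow.trans (one_pow _).symm)
    exact hone (by rw [← hz, hz1, map_one])
  have e := IsCyclotomicExtension.algEquiv {(ℓ : ℕ)} F (AdjoinRoot M.charpoly)
    (CyclotomicField ℓ F)
  exact ⟨hirr, e.toLinearEquiv.finrank_eq ▸ hfin, ⟨e⟩⟩
end

section
/- Let R be a commutative ring, let γ ∈ GL₂(R) be an invertible 2×2 matrix with trace t and determinant s ∈ R^×, and let q ∈ R. Let V ⊆ M₂(R) be the R-submodule of trace-zero 2×2 matrices (free of rank 3), and let Φ : V → V be the R-linear map Φ(A) = q · γAγ⁻¹ (the adjoint action of γ scaled by q). Then s · det(Φ − id_V) = (q − 1)·(s(q + 1)² − q t²). -/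
/-- Trace-zero `2 × 2` matrices, coordinatized by the entries `A 0 0`, `A 0 1`, `A 1 0`. -/
def traceZeroEquivFun (R : Type*) [CommRing R] :
    ↥(LinearMap.ker (Matrix.traceLinearMap (Fin 2) R R)) ≃ₗ[R] (Fin 3 → R) where
  toFun A := ![A.1 0 0, A.1 0 1, A.1 1 0]
  invFun v := ⟨!![v 0, v 1; v 2, -v 0], by simp [Matrix.trace_fin_two]⟩
  map_add' A B := by ext i; fin_cases i <;> rfl
  map_smul' r A := by ext i; fin_cases i <;> rfl
  left_inv A := by
    have h : A.1 0 0 + A.1 1 1 = 0 :=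
      (Matrix.trace_fin_two A.1).symm.trans (LinearMap.mem_ker.mp A.2)
    ext i j
    fin_cases i <;> fin_cases j <;> simp
    exact (eq_neg_of_add_eq_zero_right h).symm
  right_inv v := by ext i; fin_cases i <;> rfl

/-- Let `R` be a commutative ring, `γ ∈ GL₂(R)` with trace `t` and
determinant `s`, and `q ∈ R`.  Let `V` be the `R`-module of trace-zero `2×2` matrices and
`Φ : V → V` the `R`-linear map `A ↦ q·γAγ⁻¹`.  Then
`s · det(Φ − id) = (q − 1)·(s(q + 1)² − q·t²)`. -/
theorem det_adjoint_action_sub_id {R : Type*} [CommRing R]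
    (γ : Matrix.GeneralLinearGroup (Fin 2) R) (q : R)
    (Φ : ↥(LinearMap.ker (Matrix.traceLinearMap (Fin 2) R R)) →ₗ[R]
         ↥(LinearMap.ker (Matrix.traceLinearMap (Fin 2) R R)))
    (hΦ : ∀ A : ↥(LinearMap.ker (Matrix.traceLinearMap (Fin 2) R R)),
      (Φ A : Matrix (Fin 2) (Fin 2) R) =
        q • ((γ : Matrix (Fin 2) (Fin 2) R) * (A : Matrix (Fin 2) (Fin 2) R) *
          ((γ⁻¹ : Matrix.GeneralLinearGroup (Fin 2) R) : Matrix (Fin 2) (Fin 2) R))) :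
    Matrix.det (γ : Matrix (Fin 2) (Fin 2) R) * LinearMap.det (Φ - LinearMap.id) =
      (q - 1) * (Matrix.det (γ : Matrix (Fin 2) (Fin 2) R) * (q + 1) ^ 2 -
        q * (Matrix.trace (γ : Matrix (Fin 2) (Fin 2) R)) ^ 2) := by
  obtain ⟨u, hu, hinv⟩ : ∃ u : R, Matrix.det (γ : Matrix (Fin 2) (Fin 2) R) * u = 1 ∧
      ((γ⁻¹ : Matrix.GeneralLinearGroup (Fin 2) R) : Matrix (Fin 2) (Fin 2) R) =
        u • Matrix.adjugate (γ : Matrix (Fin 2) (Fin 2) R) :=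
    ⟨Ring.inverse (Matrix.det (γ : Matrix (Fin 2) (Fin 2) R)),
      Ring.mul_inverse_cancel _ ((Matrix.isUnit_iff_isUnit_det _).mp γ.isUnit),
      by rw [Matrix.coe_units_inv, Matrix.inv_def]⟩
  generalize (γ : Matrix (Fin 2) (Fin 2) R) = g at hu hinv hΦ ⊢
  rw [hinv] at hΦ
  rw [← LinearMap.det_toMatrix (Module.Basis.ofEquivFun (traceZeroEquivFun R)), Matrix.det_fin_three]
  simp only [LinearMap.toMatrix_apply, Module.Basis.ofEquivFun_repr_apply,
    Module.Basis.coe_ofEquivFun]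
  simp [traceZeroEquivFun, hΦ, Matrix.mul_apply, Fin.sum_univ_two, Matrix.adjugate_fin_two,
    Matrix.trace_fin_two, Matrix.det_fin_two] at hu ⊢
  linear_combination (q ^ 3 * (g 0 0 * g 1 1 - g 0 1 * g 1 0) *
      (((g 0 0 * g 1 1 - g 0 1 * g 1 0) * u) ^ 2 + (g 0 0 * g 1 1 - g 0 1 * g 1 0) * u + 1) -
    q ^ 2 * ((g 0 0 + g 1 1) ^ 2 - (g 0 0 * g 1 1 - g 0 1 * g 1 0)) *
      ((g 0 0 * g 1 1 - g 0 1 * g 1 0) * u + 1) +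
    q * ((g 0 0 + g 1 1) ^ 2 - (g 0 0 * g 1 1 - g 0 1 * g 1 0))) * hu
end

section
/- Let O be a commutative ring, let Δ be a finite group, let G be a finite abelian group whose order is invertible in O, and let χ : G → O^× be a group homomorphism. Let M be an O-module equipped with two commuting O-linear actions, one of Δ and one of G (equivalently, M is an O[Δ × G]-module), and set M[χ] := {m ∈ M : σ·m = χ(σ)·m for all σ ∈ G}. Then: (a) M[χ] is an O[Δ]-submodule of M and a direct summand of M as an O[Δ]-module, namely the image of the idempotent e_χ = |G|⁻¹ ∑_{σ∈G} χ(σ)⁻¹ σ; (b) the natural map M[χ] ⊗_{O[Δ]} O → (M ⊗_{O[Δ]} O)[χ] is an isomorphism of O-modules, where O is an O[Δ]-algebra via the augmentation map; (c) if moreover O is a local ring whose residue field has characteristic p, Δ is a finite p-group, and M is free of finite rank as an O[Δ]-module, then M[χ] is free as an O[Δ]-module. -/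
/-! **Statement 7.**  Setup: `M` is an `O`-module with two commuting `O`-linear actions of a
group `Δ` and of a finite abelian group `G` whose order is invertible in `O`; this is
encoded by letting `M` be a module over the group algebra `O[Δ] = MonoidAlgebra O Δ`
(the `Δ`-action) and letting `G` act through `O[Δ]`-linear automorphisms (an `O[Δ]`-linear
action is exactly an `O`-linear action commuting with the `Δ`-action). -/

section IsotypicDefs

variable {O : Type*} [CommRing O] {Δ : Type*} [Group Δ] {G : Type*} [CommGroup G] [Fintype G]
variable {M : Type*} [AddCommGroup M] [Module O M]
variable [Module (MonoidAlgebra O Δ) M] [IsScalarTower O (MonoidAlgebra O Δ) M]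
variable [SMulCommClass (MonoidAlgebra O Δ) O M]

/-- The `χ`-isotypic part `M[χ] = {m : σ·m = χ(σ)·m for all σ ∈ G}`, an `O[Δ]`-submodule. -/
noncomputable def isotypicPart (χ : G →* Oˣ) (ρ : G →* (M ≃ₗ[MonoidAlgebra O Δ] M)) :
    Submodule (MonoidAlgebra O Δ) M :=
  ⨅ σ : G, LinearMap.eqLocus (ρ σ : M →ₗ[MonoidAlgebra O Δ] M)
    (((χ σ : Oˣ) : O) • (LinearMap.id : M →ₗ[MonoidAlgebra O Δ] M))

/-- The averaging idempotent `e_χ = |G|⁻¹ ∑_{σ∈G} χ(σ)⁻¹ σ`. -/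
noncomputable def avgIdempotent (χ : G →* Oˣ) (ρ : G →* (M ≃ₗ[MonoidAlgebra O Δ] M)) :
    M →ₗ[MonoidAlgebra O Δ] M :=
  Ring.inverse ((Fintype.card G : O)) •
    ∑ σ : G, (((χ σ)⁻¹ : Oˣ) : O) • (ρ σ : M →ₗ[MonoidAlgebra O Δ] M)

variable (O Δ M) in
/-- The submodule of `M` generated by the elements `δ·m − m`; the quotient `M ⧸ coinvKer`
is the space of `Δ`-coinvariants, i.e. `M ⊗_{O[Δ]} O` with `O` an `O[Δ]`-algebra via the
augmentation map. -/
noncomputable def coinvKer : Submodule (MonoidAlgebra O Δ) M :=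
  Submodule.span (MonoidAlgebra O Δ)
    {x : M | ∃ (δ : Δ) (m : M), x = (MonoidAlgebra.of O Δ δ) • m - m}

/-- The induced `G`-action on the coinvariants `M ⊗_{O[Δ]} O`. -/
noncomputable def coinvAct (ρ : G →* (M ≃ₗ[MonoidAlgebra O Δ] M)) (σ : G) :
    (M ⧸ coinvKer O Δ M) →ₗ[MonoidAlgebra O Δ] (M ⧸ coinvKer O Δ M) :=
  Submodule.mapQ _ _ (ρ σ : M →ₗ[MonoidAlgebra O Δ] M) (by
    refine Submodule.span_le.2 ?_
    rintro x ⟨δ, m, rfl⟩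
    simp only [SetLike.mem_coe, Submodule.mem_comap, map_sub, map_smul]
    exact Submodule.subset_span ⟨δ, ρ σ m, rfl⟩)

/-- The `χ`-isotypic part `(M ⊗_{O[Δ]} O)[χ]` of the coinvariants. -/
noncomputable def coinvIsotypicPart (χ : G →* Oˣ) (ρ : G →* (M ≃ₗ[MonoidAlgebra O Δ] M)) :
    Submodule (MonoidAlgebra O Δ) (M ⧸ coinvKer O Δ M) :=
  ⨅ σ : G, LinearMap.eqLocus (coinvAct ρ σ)
    (((χ σ : Oˣ) : O) • (LinearMap.id : (M ⧸ coinvKer O Δ M) →ₗ[MonoidAlgebra O Δ] (M ⧸ coinvKer O Δ M)))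

/-- The natural map `M[χ] ⊗_{O[Δ]} O → M ⊗_{O[Δ]} O`, i.e. from the coinvariants of the
isotypic part to the coinvariants of `M`. -/
noncomputable def isotypicCoinvMap (χ : G →* Oˣ) (ρ : G →* (M ≃ₗ[MonoidAlgebra O Δ] M)) :
    (↥(isotypicPart χ ρ) ⧸ coinvKer O Δ ↥(isotypicPart χ ρ)) →ₗ[MonoidAlgebra O Δ]
      (M ⧸ coinvKer O Δ M) :=
  Submodule.mapQ _ _ (isotypicPart χ ρ).subtype (by
    refine Submodule.span_le.2 ?_
    rintro x ⟨δ, m, rfl⟩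
    simp only [SetLike.mem_coe, Submodule.mem_comap, map_sub, map_smul, Submodule.subtype_apply]
    exact Submodule.subset_span ⟨δ, (m : M), rfl⟩)

end IsotypicDefs

section IsotypicLemmas

/-- Averaging a function that is constant equal to `x` gives back `x`. -/
theorem inverse_card_smul_sum_const {O G N : Type*} [CommRing O] [Fintype G] [AddCommGroup N]
    [Module O N] (hcard : IsUnit (Fintype.card G : O)) {f : G → N} {x : N} (hf : ∀ σ, f σ = x) :
    Ring.inverse (Fintype.card G : O) • ∑ σ : G, f σ = x := by
  simp_rw [hf]
  rw [Finset.sum_const, Finset.card_univ, ← Nat.cast_smul_eq_nsmul O, smul_smul,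
    Ring.inverse_mul_cancel _ hcard, one_smul]

theorem coinvKer_le_comap {O : Type*} [CommRing O] {Δ : Type*} [Group Δ] {M N : Type*}
    [AddCommGroup M] [Module (MonoidAlgebra O Δ) M] [AddCommGroup N] [Module (MonoidAlgebra O Δ) N]
    (f : M →ₗ[MonoidAlgebra O Δ] N) : coinvKer O Δ M ≤ (coinvKer O Δ N).comap f := by
  refine Submodule.span_le.2 ?_
  rintro _ ⟨δ, m, rfl⟩
  exact Submodule.subset_span ⟨δ, f m, by simp only [map_sub, map_smul]⟩

variable {O : Type*} [CommRing O] {Δ : Type*} [Group Δ] {G : Type*} [CommGroup G]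
variable {M : Type*} [AddCommGroup M] [Module O M]
variable [Module (MonoidAlgebra O Δ) M] [SMulCommClass (MonoidAlgebra O Δ) O M]
variable {χ : G →* Oˣ} {ρ : G →* (M ≃ₗ[MonoidAlgebra O Δ] M)}

theorem mem_isotypicPart {x : M} :
    x ∈ isotypicPart χ ρ ↔ ∀ σ, ρ σ x = ((χ σ : Oˣ) : O) • x := by
  simp [isotypicPart]

variable [IsScalarTower O (MonoidAlgebra O Δ) M] in
theorem mem_coinvIsotypicPart {x : M ⧸ coinvKer O Δ M} :
    x ∈ coinvIsotypicPart χ ρ ↔ ∀ σ, coinvAct ρ σ x = ((χ σ : Oˣ) : O) • x := by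
  simp [coinvIsotypicPart]

variable [Fintype G]

theorem avgIdempotent_apply (x : M) :
    avgIdempotent χ ρ x =
      Ring.inverse (Fintype.card G : O) • ∑ σ : G, (((χ σ)⁻¹ : Oˣ) : O) • ρ σ x := by
  simp [avgIdempotent]

theorem avgIdempotent_apply_of_mem (hcard : IsUnit (Fintype.card G : O)) {x : M}
    (hx : x ∈ isotypicPart χ ρ) : avgIdempotent χ ρ x = x := by
  rw [avgIdempotent_apply]
  refine inverse_card_smul_sum_const hcard fun σ ↦ ?_
  rw [mem_isotypicPart.1 hx, smul_smul, Units.inv_mul, one_smul]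

variable [IsScalarTower O (MonoidAlgebra O Δ) M]

theorem avgIdempotent_mem (x : M) : avgIdempotent χ ρ x ∈ isotypicPart χ ρ := by
  refine mem_isotypicPart.2 fun τ ↦ ?_
  have hO (c : O) (y : M) : ρ τ (c • y) = c • ρ τ y :=
    (ρ τ : M →ₗ[MonoidAlgebra O Δ] M).map_smul_of_tower c y
  rw [avgIdempotent_apply, hO, map_sum, smul_comm _ (Ring.inverse _)]
  congr 1
  rw [Finset.smul_sum]
  refine Fintype.sum_equiv (Equiv.mulLeft τ) _ _ fun σ ↦ ?_
  rw [hO, Equiv.coe_mulLeft, map_mul, map_mul, smul_smul, LinearEquiv.mul_apply]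
  congr 1
  rw [← Units.val_mul, mul_inv, mul_inv_cancel_left]

theorem isotypicPart_eq_range (hcard : IsUnit (Fintype.card G : O)) :
    isotypicPart χ ρ = LinearMap.range (avgIdempotent χ ρ) :=
  le_antisymm (fun x hx ↦ ⟨x, avgIdempotent_apply_of_mem hcard hx⟩)
    (by rintro _ ⟨x, rfl⟩; exact avgIdempotent_mem x)

variable (χ ρ) in
/-- The projection of `M` onto `M[χ]` given by `e_χ`. -/
noncomputable def isotypicProj : M →ₗ[MonoidAlgebra O Δ] isotypicPart χ ρ :=
  (avgIdempotent χ ρ).codRestrict _ avgIdempotent_mem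

theorem isotypicProj_apply_coe (hcard : IsUnit (Fintype.card G : O)) (x : isotypicPart χ ρ) :
    isotypicProj χ ρ x = x :=
  Subtype.ext (avgIdempotent_apply_of_mem hcard x.2)

theorem isotypicCoinvMap_injective (hcard : IsUnit (Fintype.card G : O)) :
    Function.Injective (isotypicCoinvMap χ ρ) := by
  refine (injective_iff_map_eq_zero _).2 fun y hy ↦ ?_
  obtain ⟨x, rfl⟩ := Submodule.Quotient.mk_surjective _ y
  have hx : (x : M) ∈ coinvKer O Δ M := (Submodule.Quotient.mk_eq_zero _).1 hy
  have := coinvKer_le_comap (isotypicProj χ ρ) hx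
  rw [Submodule.mem_comap, isotypicProj_apply_coe hcard] at this
  exact (Submodule.Quotient.mk_eq_zero _).2 this

theorem range_isotypicCoinvMap (hcard : IsUnit (Fintype.card G : O)) :
    LinearMap.range (isotypicCoinvMap χ ρ) = coinvIsotypicPart χ ρ := by
  apply le_antisymm
  · rintro _ ⟨y, rfl⟩
    obtain ⟨x, rfl⟩ := Submodule.Quotient.mk_surjective _ y
    refine mem_coinvIsotypicPart.2 fun σ ↦ ?_
    exact congrArg (coinvKer O Δ M).mkQ (mem_isotypicPart.1 x.2 σ)
  · intro y hy
    obtain ⟨m, rfl⟩ := Submodule.Quotient.mk_surjective _ y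
    refine ⟨Submodule.Quotient.mk (isotypicProj χ ρ m), ?_⟩
    change (coinvKer O Δ M).mkQ (avgIdempotent χ ρ m) = _
    rw [avgIdempotent_apply, LinearMap.map_smul_of_tower, map_sum]
    refine inverse_card_smul_sum_const hcard fun σ ↦ ?_
    have h : (coinvKer O Δ M).mkQ (ρ σ m) = ((χ σ : Oˣ) : O) • (coinvKer O Δ M).mkQ m :=
      mem_coinvIsotypicPart.1 hy σ
    rw [LinearMap.map_smul_of_tower, h, smul_smul, Units.inv_mul, one_smul]
    rfl

end IsotypicLemmas

section LocalRing

/-- A finite projective module over a ring in which every element outside the Jacobson radical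
is left invertible (i.e. over a local ring, not necessarily commutative) is free. -/
theorem Module.free_of_projective_of_forall_notMem_jacobson {R : Type*} [Ring R]
    (hR : ∀ a : R, a ∉ Ring.jacobson R → ∃ b, b * a = 1)
    (P : Type*) [AddCommGroup P] [Module R P] [Module.Finite R P] [Module.Projective R P] :
    Module.Free R P := by
  classical
  have hex : ∃ n, ∃ x : Fin n → P, Submodule.span R (Set.range x) = ⊤ :=
    Module.Finite.exists_fin
  obtain ⟨n, ⟨x, hx⟩, hmin⟩ : ∃ n, (∃ x : Fin n → P, Submodule.span R (Set.range x) = ⊤) ∧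
      ∀ k < n, ¬∃ x : Fin k → P, Submodule.span R (Set.range x) = ⊤ :=
    ⟨Nat.find hex, Nat.find_spec hex, fun _ ↦ Nat.find_min hex⟩
  let φ : (Fin n → R) →ₗ[R] P := Fintype.linearCombination R x
  have hφ : Function.Surjective φ := by
    rw [← LinearMap.range_eq_top, Fintype.range_linearCombination, hx]
  have hker (a : Fin n → R) (ha : φ a = 0) (i : Fin n) : a i ∈ Ring.jacobson R := by
    by_contra hai
    obtain ⟨b, hb⟩ := hR _ hai
    obtain ⟨k, rfl⟩ : ∃ k, n = k + 1 := ⟨n - 1, by have := i.pos; omega⟩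
    refine hmin k k.lt_succ_self ⟨x ∘ i.succAbove, top_le_iff.1 (hx ▸ Submodule.span_le.2 ?_)⟩
    have hmem (j) : x (i.succAbove j) ∈ Submodule.span R (Set.range (x ∘ i.succAbove)) :=
      Submodule.subset_span ⟨j, rfl⟩
    rintro _ ⟨j, rfl⟩
    obtain rfl | ⟨j, rfl⟩ := Fin.eq_self_or_eq_succAbove i j
    · have h0 : a j • x j + ∑ l, a (j.succAbove l) • x (j.succAbove l) = 0 := by
        rw [← Fin.sum_univ_succAbove (fun l ↦ a l • x l) j]
        exact ha
      have : x j = -(b • ∑ l, a (j.succAbove l) • x (j.succAbove l)) := by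
        rw [← smul_neg, ← eq_neg_of_add_eq_zero_left h0, smul_smul, hb, one_smul]
      rw [this]
      exact neg_mem (Submodule.smul_mem _ _ (sum_mem fun l _ ↦ Submodule.smul_mem _ _ (hmem l)))
    · exact hmem j
  obtain ⟨s, hs⟩ := Module.projective_lifting_property φ LinearMap.id hφ
  let π : (Fin n → R) →ₗ[R] (Fin n → R) := LinearMap.id - s ∘ₗ φ
  have hπ : LinearMap.range π = LinearMap.ker φ := by
    apply le_antisymm
    · rintro _ ⟨y, rfl⟩
      have : φ (s (φ y)) = φ y := LinearMap.congr_fun hs (φ y)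
      simp [π, this]
    · intro y hy
      exact ⟨y, by simp_all [π]⟩
  have hbot : LinearMap.ker φ = ⊥ := by
    refine Submodule.FG.eq_bot_of_le_jacobson_smul
      (hπ ▸ LinearMap.range_eq_map π ▸ Module.Finite.fg_top.map π) fun y hy ↦ ?_
    have hy' : π y = y := by simp_all [π]
    rw [← hy', pi_eq_sum_univ' y, map_sum]
    refine sum_mem fun i _ ↦ ?_
    rw [map_smul]
    exact Submodule.smul_mem_smul (hker y hy i) (hπ ▸ LinearMap.mem_range_self _ _)
  exact Module.Free.of_equiv (LinearEquiv.ofBijective φ ⟨LinearMap.ker_eq_bot.1 hbot, hφ⟩)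

end LocalRing

section PGroup

/-- A finite `p`-group acting linearly on a nonzero abelian group of exponent `p` has a nonzero
fixed point. -/
theorem IsPGroup.exists_ne_zero_forall_smul_eq {p : ℕ} [Fact p.Prime] {Δ : Type*} [Group Δ]
    [Finite Δ] (hΔ : IsPGroup p Δ) (V : Type*) [AddCommGroup V] [Module (ZMod p) V]
    [DistribMulAction Δ V] [Nontrivial V] : ∃ v : V, v ≠ 0 ∧ ∀ δ : Δ, δ • v = v := by
  obtain ⟨v, hv⟩ := exists_ne (0 : V)
  let A : Submodule (ZMod p) V := Submodule.span _ (MulAction.orbit Δ v)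
  have hfin : (MulAction.orbit Δ v).Finite := Set.finite_range _
  have : Module.Finite (ZMod p) A := FiniteDimensional.span_of_finite (ZMod p) hfin
  have : Finite A := Module.finite_of_finite (ZMod p)
  have hvA : v ∈ A := Submodule.subset_span (MulAction.mem_orbit_self v)
  have : Nontrivial A := ⟨⟨v, hvA⟩, 0, fun h ↦ hv (congrArg Subtype.val h)⟩
  let B : SubMulAction Δ V :=
    { carrier := A
      smul_mem' := fun δ a ha ↦ by
        have : A ≤ A.comap ((DistribSMul.toAddMonoidHom V δ).toZModLinearMap p) := by
          refine Submodule.span_le.2 ?_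
          rintro _ ⟨γ, rfl⟩
          exact Submodule.subset_span ⟨δ * γ, mul_smul δ γ v⟩
        exact this ha }
  have : Finite B := ‹Finite A›
  have hcard : p ∣ Nat.card B := by
    change p ∣ Nat.card A
    rw [Module.natCard_eq_pow_finrank (K := ZMod p), Nat.card_zmod]
    exact dvd_pow_self p Module.finrank_pos.ne'
  let z : B := ⟨0, A.zero_mem⟩
  have hz : z ∈ MulAction.fixedPoints Δ B := fun δ ↦ Subtype.ext (smul_zero δ)
  obtain ⟨b, hb, hne⟩ := hΔ.exists_fixed_point_of_prime_dvd_card_of_fixed_point B hcard hz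
  exact ⟨b, fun h ↦ hne (Subtype.ext h.symm), fun δ ↦ congrArg Subtype.val (hb δ)⟩

end PGroup

section GroupAlgebra

open IsLocalRing

variable {O : Type*} [CommRing O] {Δ : Type*} [Group Δ]

variable (O Δ) in
/-- The augmentation map `O[Δ] → O`. -/
noncomputable def groupAlgebraAug : MonoidAlgebra O Δ →ₐ[O] O := MonoidAlgebra.lift O O Δ 1

theorem smul_eq_groupAlgebraAug_smul {S : Type*} [AddCommGroup S] [Module O S]
    [Module (MonoidAlgebra O Δ) S] [IsScalarTower O (MonoidAlgebra O Δ) S] {s : S}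
    (hs : ∀ δ, MonoidAlgebra.of O Δ δ • s = s) (r : MonoidAlgebra O Δ) :
    r • s = groupAlgebraAug O Δ r • s := by
  induction r using MonoidAlgebra.induction_on with
  | of δ => rw [hs]; simp [groupAlgebraAug]
  | add a b ha hb => rw [add_smul, ha, hb, map_add, add_smul]
  | smul c a ha => rw [smul_assoc, ha, map_smul, smul_assoc]

variable [IsLocalRing O] [Finite Δ]

/-- The maximal ideal of `O` annihilates every simple `O[Δ]`-module. -/
theorem smul_eq_zero_of_isSimpleModule {S : Type*} [AddCommGroup S] [Module O S]
    [Module (MonoidAlgebra O Δ) S] [IsScalarTower O (MonoidAlgebra O Δ) S]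
    [IsSimpleModule (MonoidAlgebra O Δ) S]
    {c : O} (hc : c ∈ maximalIdeal O) (s : S) : c • s = 0 := by
  have : SMulCommClass (MonoidAlgebra O Δ) O S := IsScalarTower.to_smulCommClass'
  have : Module.Finite O (MonoidAlgebra O Δ) := Module.Finite.of_basis (MonoidAlgebra.basis Δ O)
  have : Module.Finite O S := .trans (MonoidAlgebra O Δ) S
  let f : S →ₗ[MonoidAlgebra O Δ] S := c • LinearMap.id
  obtain hf | hf := f.bijective_or_eq_zero
  · have htop : (⊤ : Submodule O S) = ⊥ := by
      refine Submodule.eq_bot_of_le_smul_of_le_jacobson_bot (maximalIdeal O) _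
        Module.Finite.fg_top (fun x _ ↦ ?_) (maximalIdeal_le_jacobson _)
      obtain ⟨y, rfl⟩ := hf.2 x
      exact Submodule.smul_mem_smul hc trivial
    exact (Submodule.mem_bot O).1 (htop ▸ Submodule.mem_top)
  · exact LinearMap.congr_fun hf s

theorem mem_jacobson_of_groupAlgebraAug_mem {p : ℕ} (hp : p.Prime) (hΔ : IsPGroup p Δ)
    [CharP (ResidueField O) p] {r : MonoidAlgebra O Δ}
    (hr : groupAlgebraAug O Δ r ∈ maximalIdeal O) : r ∈ Ring.jacobson (MonoidAlgebra O Δ) := by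
  rw [Ring.jacobson_eq_sInf_isMaximal, Submodule.mem_sInf]
  intro m hm
  let S := MonoidAlgebra O Δ ⧸ m
  have hsimple : IsSimpleModule (MonoidAlgebra O Δ) S :=
    isSimpleModule_iff_isCoatom.2 (Ideal.isMaximal_def.1 hm)
  have hmax (c : O) (hc : c ∈ maximalIdeal O) (s : S) : c • s = 0 :=
    smul_eq_zero_of_isSimpleModule (Δ := Δ) hc s
  have hpS (s : S) : p • s = 0 := by
    rw [← Nat.cast_smul_eq_nsmul O]
    exact hmax _ ((residue_eq_zero_iff _).1 (by rw [map_natCast, CharP.cast_eq_zero])) s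
  have : Nontrivial S := IsSimpleModule.nontrivial (MonoidAlgebra O Δ) S
  let : DistribMulAction Δ S := DistribMulAction.compHom S (MonoidAlgebra.of O Δ)
  have : Fact p.Prime := ⟨hp⟩
  let : Module (ZMod p) S := AddCommGroup.zmodModule hpS
  obtain ⟨s, hs, hfix⟩ := hΔ.exists_ne_zero_forall_smul_eq S
  obtain ⟨t, ht⟩ := IsSimpleModule.toSpanSingleton_surjective (MonoidAlgebra O Δ) hs
    (Submodule.Quotient.mk 1)
  rw [LinearMap.toSpanSingleton_apply] at ht
  have : r • (Submodule.Quotient.mk 1 : S) = 0 := by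
    rw [← ht, smul_smul, smul_eq_groupAlgebraAug_smul hfix, map_mul, mul_smul, hmax _ hr]
  rwa [← Submodule.Quotient.mk_smul, Submodule.Quotient.mk_eq_zero, smul_eq_mul, mul_one] at this

theorem exists_mul_eq_one_of_notMem_jacobson {p : ℕ} (hp : p.Prime) (hΔ : IsPGroup p Δ)
    [CharP (ResidueField O) p] {r : MonoidAlgebra O Δ}
    (hr : r ∉ Ring.jacobson (MonoidAlgebra O Δ)) : ∃ b, b * r = 1 := by
  have hu : IsUnit (groupAlgebraAug O Δ r) := by
    by_contra h
    exact hr (mem_jacobson_of_groupAlgebraAug_mem hp hΔ h)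
  obtain ⟨c, hc⟩ := hu.exists_left_inv
  have hmem : c • r - 1 ∈ Ring.jacobson (MonoidAlgebra O Δ) :=
    mem_jacobson_of_groupAlgebraAug_mem hp hΔ (by simp [hc])
  rw [← Ideal.jacobson_bot] at hmem
  obtain ⟨b, hb⟩ := Ideal.exists_mul_sub_mem_of_sub_one_mem_jacobson _ hmem
  refine ⟨c • b, ?_⟩
  rw [smul_mul_assoc, ← mul_smul_comm]
  exact sub_eq_zero.1 hb

end GroupAlgebra

/-- Let `O` be a commutative ring, `Δ` a finite group, `G` a finite
abelian group whose order is invertible in `O`, `χ : G → O^×` a character, and `M` an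
`O`-module with commuting `O`-linear actions of `Δ` (via the `O[Δ]`-module structure) and
of `G` (via `ρ`).  Then: (a) `M[χ]` is an `O[Δ]`-submodule which is a direct summand of
`M` as an `O[Δ]`-module, namely the image of the idempotent `e_χ`; (b) the natural map
`M[χ] ⊗_{O[Δ]} O → (M ⊗_{O[Δ]} O)[χ]` is an isomorphism; (c) if moreover `O` is local
with residue characteristic `p`, `Δ` is a finite `p`-group and `M` is free of finite rank
over `O[Δ]`, then `M[χ]` is free over `O[Δ]`. -/
theorem isotypicPart_summand_coinvariants_and_free
    {O : Type*} [CommRing O] {Δ : Type*} [Group Δ] {G : Type*} [CommGroup G] [Fintype G]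
    {M : Type*} [AddCommGroup M] [Module O M]
    [Module (MonoidAlgebra O Δ) M] [IsScalarTower O (MonoidAlgebra O Δ) M]
    [SMulCommClass (MonoidAlgebra O Δ) O M]
    (hcard : IsUnit (Fintype.card G : O))
    (χ : G →* Oˣ) (ρ : G →* (M ≃ₗ[MonoidAlgebra O Δ] M)) :
    -- (a)
    ((avgIdempotent χ ρ).comp (avgIdempotent χ ρ) = avgIdempotent χ ρ ∧
      isotypicPart χ ρ = LinearMap.range (avgIdempotent χ ρ) ∧
      ∃ N : Submodule (MonoidAlgebra O Δ) M, IsCompl (isotypicPart χ ρ) N) ∧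
    -- (b)
    (Function.Injective (isotypicCoinvMap χ ρ) ∧
      LinearMap.range (isotypicCoinvMap χ ρ) = coinvIsotypicPart χ ρ) ∧
    -- (c)
    (∀ p : ℕ, p.Prime → IsPGroup p Δ → Finite Δ →
      ∀ (hO : IsLocalRing O), CharP (@IsLocalRing.ResidueField O _ hO) p →
      Module.Free (MonoidAlgebra O Δ) M → Module.Finite (MonoidAlgebra O Δ) M →
      Module.Free (MonoidAlgebra O Δ) ↥(isotypicPart χ ρ)) := by
  refine ⟨⟨?_, isotypicPart_eq_range hcard, LinearMap.ker (isotypicProj χ ρ), ?_⟩,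
    ⟨isotypicCoinvMap_injective hcard, range_isotypicCoinvMap hcard⟩, ?_⟩
  · exact LinearMap.ext fun x ↦ avgIdempotent_apply_of_mem hcard (avgIdempotent_mem x)
  · exact LinearMap.isCompl_of_proj (isotypicProj_apply_coe hcard)
  · intro p hp hΔ _ hO _ _ _
    have : Module.Finite (MonoidAlgebra O Δ) (isotypicPart χ ρ) :=
      .of_surjective (isotypicProj χ ρ) fun x ↦ ⟨x, isotypicProj_apply_coe hcard x⟩
    have : Module.Projective (MonoidAlgebra O Δ) (isotypicPart χ ρ) :=
      .of_split (isotypicPart χ ρ).subtype (isotypicProj χ ρ)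
        (LinearMap.ext (isotypicProj_apply_coe hcard))
    exact Module.free_of_projective_of_forall_notMem_jacobson
      (fun _ ↦ exists_mul_eq_one_of_notMem_jacobson hp hΔ) _
end
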